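/- Let ξ be a cost-sharing scheme satisfying Fence Monotonicity. Then for every bid vector b there exists a pair (L,U) with L ⊆ U ⊆ A that is stable at b (and this stable pair is unique). -/

import Mathlib

open Finset

variable {n : ℕ}

/-- A cost-sharing scheme: nonnegative payments, and zero payment for non-serviced players. -/
def IsCostSharingScheme (ξ : Fin n → Finset (Fin n) → ℝ) : Prop :=
  (∀ i S, 0 ≤ ξ i S) ∧ (∀ i S, i ∉ S → ξ i S = 0)

/-- The minimum payment ξ*(i,L,U) = min{ ξ(i,S) : L ⊆ S ⊆ U, i ∈ S }. -/
noncomputable def xiStar (ξ : Fin n → Finset (Fin n) → ℝ) (L U : Finset (Fin n)) (i : Fin n) : ℝ :=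
  sInf {x : ℝ | ∃ S : Finset (Fin n), L ⊆ S ∧ S ⊆ U ∧ i ∈ S ∧ ξ i S = x}

/-- Fence Monotonicity at a pair L ⊆ U. -/
def FenceMonoAt (ξ : Fin n → Finset (Fin n) → ℝ) (L U : Finset (Fin n)) : Prop :=
  (∃ S : Finset (Fin n), L ⊆ S ∧ S ⊆ U ∧ ∀ i ∈ S, ξ i S = xiStar ξ L U i) ∧
  (∀ i ∈ U \ L, ∃ S : Finset (Fin n), L ⊆ S ∧ S ⊆ U ∧ i ∈ S ∧
    ∀ j ∈ S \ L, ξ j S = xiStar ξ L U j) ∧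
  (∀ C : Finset (Fin n), C ⊂ U → (∃ i ∈ C, ξ i C < xiStar ξ L U i) →
    ∃ T : Finset (Fin n), T.Nonempty ∧ T ⊆ L \ C ∧ ∀ j ∈ T, ξ j (C ∪ T) = xiStar ξ L U j)

/-- Fence Monotonicity: the three conditions hold at every pair L ⊆ U. -/
def FenceMonotone (ξ : Fin n → Finset (Fin n) → ℝ) : Prop :=
  ∀ L U : Finset (Fin n), L ⊆ U → FenceMonoAt ξ L U

/-- Voluntary participation: a serviced player is never charged more than her bid. -/
def VP (ξ : Fin n → Finset (Fin n) → ℝ) (O : (Fin n → ℝ) → Finset (Fin n)) : Prop :=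
  ∀ b : Fin n → ℝ, ∀ i ∈ O b, ξ i (O b) ≤ b i

/-- Consumer sovereignty: each player has a bid that guarantees service. -/
def CS (O : (Fin n → ℝ) → Finset (Fin n)) : Prop :=
  ∀ i : Fin n, ∃ bstar : ℝ, ∀ b : Fin n → ℝ, b i = bstar → i ∈ O b

/-- Utility of player `i` with true value `v i` at bid vector `b`. -/
noncomputable def utility (ξ : Fin n → Finset (Fin n) → ℝ) (O : (Fin n → ℝ) → Finset (Fin n))
    (v b : Fin n → ℝ) (i : Fin n) : ℝ :=
  if i ∈ O b then v i - ξ i (O b) else 0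

/-- Group-strategyproofness. -/
def GSP (ξ : Fin n → Finset (Fin n) → ℝ) (O : (Fin n → ℝ) → Finset (Fin n)) : Prop :=
  ∀ v v' : Fin n → ℝ,
    (∃ i : Fin n, v i ≠ v' i ∧ utility ξ O v v' i < utility ξ O v v i) ∨
    (∀ i : Fin n, utility ξ O v v' i = utility ξ O v v i)

/-- The pair (L,U) is stable at the bid vector b. -/
def StablePair (ξ : Fin n → Finset (Fin n) → ℝ) (b : Fin n → ℝ) (L U : Finset (Fin n)) : Prop :=
  L ⊆ U ∧
  (∀ i ∈ L, xiStar ξ L U i < b i) ∧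
  (∀ i ∈ U \ L, b i = xiStar ξ L U i) ∧
  (∀ R : Finset (Fin n), R ⊆ Uᶜ → R.Nonempty → ∃ i ∈ R, b i < xiStar ξ L (U ∪ R) i)

/-- Player i harms player j (at the pair L ⊆ U). -/
def Harms (ξ : Fin n → Finset (Fin n) → ℝ) (L U : Finset (Fin n)) (i j : Fin n) : Prop :=
  j ≠ i ∧ xiStar ξ L U j < xiStar ξ (insert i L) U j

section XiStar

variable {ξ : Fin n → Finset (Fin n) → ℝ} {L U L' U' S : Finset (Fin n)} {i : Fin n}

theorem xiStar_le (hξ : IsCostSharingScheme ξ) (hL : L ⊆ S) (hU : S ⊆ U) (hi : i ∈ S) :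
    xiStar ξ L U i ≤ ξ i S := by
  refine csInf_le ⟨0, ?_⟩ ⟨S, hL, hU, hi, rfl⟩
  rintro _ ⟨S, -, -, -, rfl⟩
  exact hξ.1 i S

theorem exists_eq_xiStar (ξ : Fin n → Finset (Fin n) → ℝ) (hLU : L ⊆ U) (hi : i ∈ U) :
    ∃ S, L ⊆ S ∧ S ⊆ U ∧ i ∈ S ∧ ξ i S = xiStar ξ L U i := by
  have hne : {x : ℝ | ∃ S : Finset (Fin n), L ⊆ S ∧ S ⊆ U ∧ i ∈ S ∧ ξ i S = x}.Nonempty :=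
    ⟨_, U, hLU, Subset.rfl, hi, rfl⟩
  have hfin : {x : ℝ | ∃ S : Finset (Fin n), L ⊆ S ∧ S ⊆ U ∧ i ∈ S ∧ ξ i S = x}.Finite := by
    refine (Set.finite_range (ξ i)).subset ?_
    rintro _ ⟨S, -, -, -, rfl⟩
    exact ⟨S, rfl⟩
  exact hne.csInf_mem hfin

theorem xiStar_nonneg (hξ : IsCostSharingScheme ξ) : 0 ≤ xiStar ξ L U i := by
  refine Real.sInf_nonneg ?_
  rintro _ ⟨S, -, -, -, rfl⟩
  exact hξ.1 i S

theorem xiStar_mono (hξ : IsCostSharingScheme ξ) (hL : L ⊆ L') (hLU : L' ⊆ U') (hU : U' ⊆ U)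
    (hi : i ∈ U') : xiStar ξ L U i ≤ xiStar ξ L' U' i := by
  obtain ⟨S, h1, h2, h3, h4⟩ := exists_eq_xiStar ξ hLU hi
  exact h4 ▸ xiStar_le hξ (hL.trans h1) (h2.trans hU) h3

end XiStar

namespace StablePair

variable {ξ : Fin n → Finset (Fin n) → ℝ} {b b' : Fin n → ℝ} {L U L' U' : Finset (Fin n)}

theorem le_bid (h : StablePair ξ b L U) {i : Fin n} (hi : i ∈ U) : xiStar ξ L U i ≤ b i := by
  by_cases hL : i ∈ L
  · exact (h.2.1 i hL).le
  · exact (h.2.2.1 i (mem_sdiff.2 ⟨hi, hL⟩)).ge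

theorem mem_of_lt (h : StablePair ξ b L U) {i : Fin n} (hi : i ∈ U) (hlt : xiStar ξ L U i < b i) :
    i ∈ L := by
  by_contra hL
  exact hlt.ne' (h.2.2.1 i (mem_sdiff.2 ⟨hi, hL⟩))

theorem exists_lt (h : StablePair ξ b L U) {C : Finset (Fin n)} (hC : ¬ C ⊆ U) :
    ∃ i ∈ C, i ∉ U ∧ b i < xiStar ξ L (U ∪ C) i := by
  obtain ⟨i, hi, hlt⟩ := h.2.2.2 (C \ U) (fun x hx => by simpa using (mem_sdiff.1 hx).2)
    (sdiff_nonempty.2 hC)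
  rw [union_sdiff_self_eq_union] at hlt
  exact ⟨i, (mem_sdiff.1 hi).1, (mem_sdiff.1 hi).2, hlt⟩

theorem congr_bid (h : StablePair ξ b L U) (hL : ∀ i ∈ L, xiStar ξ L U i < b' i)
    (hU : ∀ i ∈ U \ L, b' i = b i) (hU' : ∀ i ∉ U, b' i ≤ b i) : StablePair ξ b' L U := by
  refine ⟨h.1, hL, fun i hi => (hU i hi).trans (h.2.2.1 i hi), fun R hR hne => ?_⟩
  obtain ⟨i, hi, hlt⟩ := h.2.2.2 R hR hne
  exact ⟨i, hi, (hU' i (by simpa using hR hi)).trans_lt hlt⟩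

/-- A set whose members outside `U` can afford it is either contained in `U` and no cheaper than
the stable prices, or can be joined by members of `L` paying strictly less than their bids. -/
theorem subset_or_exists_joining (hξ : IsCostSharingScheme ξ) (hFM : FenceMonotone ξ)
    (h : StablePair ξ b L U) {C : Finset (Fin n)} (hC : ∀ i ∈ C, i ∉ U → ξ i C ≤ b i) :
    (C ⊆ U ∧ ∀ i ∈ C, xiStar ξ L U i ≤ ξ i C) ∨
      ∃ T : Finset (Fin n), T.Nonempty ∧ T ⊆ L \ C ∧ ∀ j ∈ T, ξ j (C ∪ T) < b j := by
  have key : (∃ i ∈ C, ξ i C < xiStar ξ L (U ∪ C) i) →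
      ∃ T : Finset (Fin n), T.Nonempty ∧ T ⊆ L \ C ∧ ∀ j ∈ T, ξ j (C ∪ T) < b j := by
    intro hlt
    have hCU : C ⊂ U ∪ C := by
      refine ssubset_of_subset_of_ne subset_union_right fun heq => ?_
      obtain ⟨i, hi, hlt⟩ := hlt
      refine hlt.not_ge (xiStar_le hξ ?_ subset_union_right hi)
      exact h.1.trans (heq ▸ subset_union_left)
    obtain ⟨T, hT, hTL, hTp⟩ := (hFM L (U ∪ C) (h.1.trans subset_union_left)).2.2 C hCU hlt
    refine ⟨T, hT, hTL, fun j hj => ?_⟩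
    have hjL := (mem_sdiff.1 (hTL hj)).1
    rw [hTp j hj]
    exact (xiStar_mono hξ Subset.rfl h.1 subset_union_left (h.1 hjL)).trans_lt (h.2.1 j hjL)
  by_cases hCU : C ⊆ U
  · by_cases hlt : ∃ i ∈ C, ξ i C < xiStar ξ L U i
    · exact Or.inr (key (by rwa [union_eq_left.2 hCU]))
    · push Not at hlt
      exact Or.inl ⟨hCU, hlt⟩
  · obtain ⟨i, hi, hiU, hlt⟩ := h.exists_lt hCU
    exact Or.inr (key ⟨i, hi, (hC i hi hiU).trans_lt hlt⟩)

theorem not_joining (hξ : IsCostSharingScheme ξ) (h : StablePair ξ b L U) {C T : Finset (Fin n)}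
    (hLC : L ⊆ C) (hCU : C ⊆ U) (hT : T.Nonempty) (hTC : Disjoint T C)
    (hlt : ∀ j ∈ T, ξ j (C ∪ T) < b j) : False := by
  by_cases hTU : T ⊆ U
  · obtain ⟨j, hj⟩ := hT
    have hjL : j ∉ L := fun hjL => disjoint_left.1 hTC hj (hLC hjL)
    refine (hlt j hj).not_ge ?_
    rw [h.2.2.1 j (mem_sdiff.2 ⟨hTU hj, hjL⟩)]
    exact xiStar_le hξ (hLC.trans subset_union_left) (union_subset hCU hTU)
      (mem_union_right _ hj)
  · obtain ⟨i, hi, -, hlt'⟩ := h.exists_lt hTU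
    exact ((hlt i hi).trans hlt').not_ge <| xiStar_le hξ (hLC.trans subset_union_left)
      (union_subset_union hCU Subset.rfl) (mem_union_right _ hi)

/-- Comparison of stable pairs at two bid vectors. -/
theorem comparison (hξ : IsCostSharingScheme ξ) (hFM : FenceMonotone ξ)
    (h : StablePair ξ b L U) (h' : StablePair ξ b' L' U')
    (hL : ∀ j ∈ L, j ∉ L' → b j ≤ b' j) (hU : ∀ j ∈ U', j ∉ U → b' j ≤ b j) :
    U' ⊆ U ∧ ∀ l ∈ L', xiStar ξ L U l ≤ xiStar ξ L' U' l := by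
  have key : ∀ C, L' ⊆ C → C ⊆ U' → (∀ i ∈ C, i ∉ U → ξ i C ≤ b' i) →
      C ⊆ U ∧ ∀ i ∈ C, xiStar ξ L U i ≤ ξ i C := by
    intro C hLC hCU hC
    rcases h.subset_or_exists_joining hξ hFM
      (fun i hi hiU => (hC i hi hiU).trans (hU i (hCU hi) hiU)) with hsub | ⟨T, hT, hTL, hTp⟩
    · exact hsub
    · refine (h'.not_joining hξ hLC hCU hT ?_ fun j hj => (hTp j hj).trans_le ?_).elim
      · exact disjoint_left.2 fun j hj => (mem_sdiff.1 (hTL hj)).2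
      · have := mem_sdiff.1 (hTL hj)
        exact hL j this.1 fun hj' => this.2 (hLC hj')
  obtain ⟨C, hLC, hCU, hC⟩ := (hFM L' U' h'.1).1
  obtain ⟨hCsub, hCle⟩ := key C hLC hCU fun i hi _ => hC i hi ▸ h'.le_bid (hCU hi)
  refine ⟨fun i hi => ?_, fun l hl => hC l (hLC hl) ▸ hCle l (hLC hl)⟩
  by_cases hiL : i ∈ L'
  · exact hCsub (hLC hiL)
  obtain ⟨S, hLS, hSU, hiS, hS⟩ := (hFM L' U' h'.1).2.1 i (mem_sdiff.2 ⟨hi, hiL⟩)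
  refine (key S hLS hSU fun j hj hjU => ?_).1 hiS
  have hjL : j ∉ L' := fun hjL => hjU (hCsub (hLC hjL))
  exact hS j (mem_sdiff.2 ⟨hj, hjL⟩) ▸ h'.le_bid (hSU hj)

theorem unique (hξ : IsCostSharingScheme ξ) (hFM : FenceMonotone ξ)
    (h : StablePair ξ b L U) (h' : StablePair ξ b L' U') : L = L' ∧ U = U' := by
  obtain ⟨hU, hL⟩ := h.comparison hξ hFM h' (fun _ _ _ => le_rfl) (fun _ _ _ => le_rfl)
  obtain ⟨hU', hL'⟩ := h'.comparison hξ hFM h (fun _ _ _ => le_rfl) (fun _ _ _ => le_rfl)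
  refine ⟨Subset.antisymm (fun l hl => ?_) (fun l hl => ?_), hU'.antisymm hU⟩
  · exact h'.mem_of_lt (hU' (h.1 hl)) ((hL' l hl).trans_lt (h.2.1 l hl))
  · exact h.mem_of_lt (hU (h'.1 hl)) ((hL l hl).trans_lt (h'.2.1 l hl))

/-- If player `i` is indifferent at the bid `a` and in `L'` at some other bid, then the pair of the
latter bid is stable at all bids of `i` above `a`. -/
theorem of_indifferent (hξ : IsCostSharingScheme ξ) (hFM : FenceMonotone ξ) {i : Fin n} {a c : ℝ}
    (h : StablePair ξ (Function.update b i a) L U) (hiU : i ∈ U) (hiL : i ∉ L)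
    (h' : StablePair ξ (Function.update b i c) L' U') (hiL' : i ∈ L') (hab : a < b i) :
    StablePair ξ b L' U' := by
  obtain ⟨hU, hL⟩ := h.comparison hξ hFM h'
    (fun j hj _ => by
      have : j ≠ i := fun e => hiL (e ▸ hj)
      simp [this])
    (fun j _ hj => by
      have : j ≠ i := fun e => hj (e ▸ hiU)
      simp [this])
  have hsub : L'.erase i ⊆ L := by
    intro l hl
    obtain ⟨hne, hl⟩ := mem_erase.1 hl
    refine h.mem_of_lt (hU (h'.1 hl)) ((hL l hl).trans_lt ?_)
    simpa [hne] using h'.2.1 l hl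
  obtain ⟨S, hLS, hSU, hiS, hS⟩ := (hFM (L'.erase i) U (hsub.trans h.1)).2.1 i
    (mem_sdiff.2 ⟨hiU, by simp⟩)
  have hL'S : L' ⊆ S := fun l hl => by
    by_cases e : l = i
    · exact e ▸ hiS
    · exact hLS (mem_erase.2 ⟨e, hl⟩)
  have hle : ∀ j ∈ S, j ∉ L'.erase i → ξ j S ≤ Function.update b i a j := fun j hj hjL => by
    rw [hS j (mem_sdiff.2 ⟨hj, hjL⟩)]
    exact (xiStar_mono hξ hsub h.1 Subset.rfl (hSU hj)).trans (h.le_bid (hSU hj))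
  have hSU' : S ⊆ U' := by
    by_contra hSU'
    obtain ⟨j, hj, hjU, hlt⟩ := h'.exists_lt hSU'
    have hji : j ≠ i := fun e => hjU (e ▸ h'.1 hiL')
    have h1 := hle j hj fun hj' => hjU (h'.1 (mem_of_mem_erase hj'))
    have h2 := xiStar_le hξ hL'S (subset_union_right : S ⊆ U' ∪ S) hj
    simp only [Function.update_of_ne hji] at h1 hlt
    linarith
  refine h'.congr_bid (fun l hl => ?_) (fun l hl => ?_) (fun l hl => ?_)
  · by_cases e : l = i
    · subst e
      have h1 := hle l hiS (by simp)
      rw [Function.update_self] at h1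
      exact ((xiStar_le hξ hL'S hSU' hiS).trans h1).trans_lt hab
    · simpa [e] using h'.2.1 l hl
  · have : l ≠ i := fun e => (mem_sdiff.1 hl).2 (e ▸ hiL')
    simp [this]
  · have : l ≠ i := fun e => hl (e ▸ h'.1 hiL')
    simp [this]

end StablePair

/-- A bid that is negative or exceeds every possible payment of the player. -/
def IsExtremeBid (ξ : Fin n → Finset (Fin n) → ℝ) (i : Fin n) (x : ℝ) : Prop :=
  x < 0 ∨ ∀ S, ξ i S < x

open Classical in
/-- Counts the payments of player `i` up to `x`, with value zero at extreme bids. -/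
noncomputable def bidWeight (ξ : Fin n → Finset (Fin n) → ℝ) (i : Fin n) (x : ℝ) : ℕ :=
  if IsExtremeBid ξ i x then 0
  else 1 + #{S | ξ i S ≤ x} + #{S | ξ i S < x}

theorem bidWeight_lt_of_extreme {ξ : Fin n → Finset (Fin n) → ℝ} {i : Fin n} {x y : ℝ}
    (hx : IsExtremeBid ξ i x) (hy : ¬ IsExtremeBid ξ i y) :
    bidWeight ξ i x < bidWeight ξ i y := by
  rw [bidWeight, bidWeight, if_pos hx, if_neg hy]
  omega

theorem bidWeight_lt_of_lt {ξ : Fin n → Finset (Fin n) → ℝ} {i : Fin n} {x y : ℝ} (hxy : x < y)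
    (hy : ¬ IsExtremeBid ξ i y) (h : ∃ S, ξ i S = x ∨ ξ i S = y) :
    bidWeight ξ i x < bidWeight ξ i y := by
  by_cases hx : IsExtremeBid ξ i x
  · exact bidWeight_lt_of_extreme hx hy
  rw [bidWeight, bidWeight, if_neg hx, if_neg hy]
  have h1 : ({S | ξ i S ≤ x} : Finset (Finset (Fin n))) ⊆
      ({S | ξ i S ≤ y} : Finset (Finset (Fin n))) :=
    fun S => by simpa using fun hS => hS.trans hxy.le
  have h2 : ({S | ξ i S < x} : Finset (Finset (Fin n))) ⊆
      ({S | ξ i S < y} : Finset (Finset (Fin n))) :=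
    fun S => by simpa using fun hS => hS.trans hxy
  have h1' := card_le_card h1
  have h2' := card_le_card h2
  obtain ⟨S, rfl | rfl⟩ := h
  · have := card_lt_card (h2.ssubset_of_mem_notMem (a := S) (by simpa using hxy) (by simp))
    omega
  · have := card_lt_card (h1.ssubset_of_mem_notMem (a := S) (by simp) (by simpa using hxy))
    omega

theorem sum_bidWeight_update_lt {ξ : Fin n → Finset (Fin n) → ℝ} {b : Fin n → ℝ} {i : Fin n}
    {x : ℝ} (h : bidWeight ξ i x < bidWeight ξ i (b i)) :
    ∑ j, bidWeight ξ j (Function.update b i x j) < ∑ j, bidWeight ξ j (b j) := by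
  refine sum_lt_sum (fun j _ => ?_) ⟨i, mem_univ i, by simpa using h⟩
  by_cases e : j = i
  · subst e
    simpa using h.le
  · simp [e]

theorem StablePair.notMem_of_neg {ξ : Fin n → Finset (Fin n) → ℝ} (hξ : IsCostSharingScheme ξ)
    {b : Fin n → ℝ} {L U : Finset (Fin n)} (h : StablePair ξ b L U) {i : Fin n} (hi : b i < 0) :
    i ∉ U :=
  fun hiU => ((h.le_bid hiU).trans_lt hi).not_ge (xiStar_nonneg hξ)

theorem StablePair.mem_of_forall_lt {ξ : Fin n → Finset (Fin n) → ℝ}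
    {b : Fin n → ℝ} {L U : Finset (Fin n)} (h : StablePair ξ b L U) {i : Fin n}
    (hi : ∀ S, ξ i S < b i) : i ∈ L := by
  have hlt : ∀ W, L ⊆ W → i ∈ W → xiStar ξ L W i < b i := fun W hW hiW => by
    obtain ⟨S, -, -, -, hS⟩ := exists_eq_xiStar ξ hW hiW
    exact hS ▸ hi S
  refine h.mem_of_lt ?_ (hlt U h.1 ?_) <;>
  · by_contra hiU
    obtain ⟨j, hj, -, hjlt⟩ := h.exists_lt (C := {i}) (by simpa using hiU)
    rw [mem_singleton] at hj
    subst hj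
    exact hjlt.not_gt (hlt _ (h.1.trans subset_union_left) (by simp))

/-- Inductive step: if every bid vector obtained by making one bid extreme, or by lowering one bid
from or to a payment, has a stable pair, then so does `b`. -/
theorem exists_stablePair_of_update {ξ : Fin n → Finset (Fin n) → ℝ} (hξ : IsCostSharingScheme ξ)
    (hFM : FenceMonotone ξ) (b : Fin n → ℝ)
    (ih : ∀ i x, bidWeight ξ i x < bidWeight ξ i (b i) →
      ∃ L U, StablePair ξ (Function.update b i x) L U) :
    ∃ L U, StablePair ξ b L U := by
  by_contra hfail
  push Not at hfail
  have notMem : ∀ i x L U, ¬ IsExtremeBid ξ i (b i) → x < b i →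
      StablePair ξ (Function.update b i x) L U → i ∉ U := by
    intro i x L U hi hx h hiU
    by_cases hiL : i ∈ L
    · refine hfail L U (h.congr_bid (fun l hl => ?_) (fun l hl => ?_) (fun l hl => ?_))
      · by_cases e : l = i
        · subst e
          have := h.2.1 l hl
          rw [Function.update_self] at this
          exact this.trans hx
        · simpa [e] using h.2.1 l hl
      · have : l ≠ i := fun e => (mem_sdiff.1 hl).2 (e ▸ hiL)
        simp [this]
      · have : l ≠ i := fun e => hl (e ▸ hiU)
        simp [this]
    · have hc : ∀ S, ξ i S < 1 + ∑ S, ξ i S := fun S => by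
        have := single_le_sum (f := ξ i) (fun S _ => hξ.1 i S) (mem_univ S)
        linarith
      obtain ⟨L', U', h'⟩ := ih i (1 + ∑ S, ξ i S) (bidWeight_lt_of_extreme (Or.inr hc) hi)
      exact hfail L' U' (h.of_indifferent hξ hFM hiU hiL h'
        (h'.mem_of_forall_lt (by simpa using hc)) hx)
  have hdrop : ∀ i, ¬ IsExtremeBid ξ i (b i) →
      ∃ L U, StablePair ξ (Function.update b i (-1)) L U := fun i hi =>
    ih i (-1) (bidWeight_lt_of_extreme (Or.inl (by norm_num)) hi)
  choose! Ld Ud hd using hdrop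
  have hdU : ∀ i, ¬ IsExtremeBid ξ i (b i) → i ∉ Ud i := fun i hi =>
    (hd i hi).notMem_of_neg hξ (by simp)
  have eq_drop : ∀ i x L U, ¬ IsExtremeBid ξ i (b i) → -1 ≤ x → x < b i →
      StablePair ξ (Function.update b i x) L U → L = Ld i ∧ U = Ud i := by
    intro i x L U hi hx1 hx h
    have hiU := notMem i x L U hi hx h
    refine StablePair.unique hξ hFM (b := Function.update b i (-1)) ?_ (hd i hi)
    refine h.congr_bid (fun l hl => ?_) (fun l hl => ?_) (fun l hl => ?_)
    · have : l ≠ i := fun e => hiU (e ▸ h.1 hl)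
      simpa [this] using h.2.1 l hl
    · have : l ≠ i := fun e => hiU (e ▸ (mem_sdiff.1 hl).1)
      simp [this]
    · by_cases e : l = i
      · subst e
        simpa using hx1
      · simp [e]
  have entry : ∀ i, ¬ IsExtremeBid ξ i (b i) → ∃ V, Ud i ⊆ V ∧ i ∈ V ∧
      (∀ j ∈ V, xiStar ξ (Ld i) V j ≤ b j) ∧ xiStar ξ (Ld i) V i = b i := by
    intro i hi
    have hs := hd i hi
    have hiU := hdU i hi
    obtain ⟨R, hR, hRne, hRle⟩ : ∃ R ⊆ (Ud i)ᶜ, R.Nonempty ∧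
        ∀ j ∈ R, xiStar ξ (Ld i) (Ud i ∪ R) j ≤ b j := by
      by_contra hcon
      push Not at hcon
      refine hfail (Ld i) (Ud i) ⟨hs.1, fun l hl => ?_, fun l hl => ?_, hcon⟩
      · have : l ≠ i := fun e => hiU (e ▸ hs.1 hl)
        simpa [this] using hs.2.1 l hl
      · have : l ≠ i := fun e => hiU (e ▸ (mem_sdiff.1 hl).1)
        simpa [this] using hs.2.2.1 l hl
    have hiR : i ∈ R := by
      by_contra hiR
      obtain ⟨j, hj, hlt⟩ := hs.2.2.2 R hR hRne
      have : j ≠ i := fun e => hiR (e ▸ hj)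
      rw [Function.update_of_ne this] at hlt
      exact hlt.not_ge (hRle j hj)
    have hiV : i ∈ Ud i ∪ R := mem_union_right _ hiR
    refine ⟨Ud i ∪ R, subset_union_left, hiV, fun j hj => ?_, ?_⟩
    · rcases mem_union.1 hj with hj | hj
      · have : j ≠ i := fun e => hiU (e ▸ hj)
        refine (xiStar_mono hξ Subset.rfl hs.1 subset_union_left hj).trans ?_
        simpa [this] using hs.le_bid hj
      · exact hRle j hj
    · refine (hRle i hiR).eq_of_not_lt fun hlt => ?_
      obtain ⟨S, -, -, -, hS⟩ := exists_eq_xiStar ξ (hs.1.trans subset_union_left) hiV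
      obtain ⟨L, U, h⟩ := ih i _ (bidWeight_lt_of_lt hlt hi ⟨S, Or.inl hS⟩)
      have h0 : 0 ≤ xiStar ξ (Ld i) (Ud i ∪ R) i := xiStar_nonneg hξ
      obtain ⟨rfl, rfl⟩ := eq_drop i _ L U hi (by linarith) hlt h
      obtain ⟨j, hj, hjlt⟩ := h.2.2.2 R hR hRne
      by_cases e : j = i
      · subst e
        simp at hjlt
      · rw [Function.update_of_ne e] at hjlt
        exact hjlt.not_ge (hRle j hj)
  choose! V hUV hiV hVle hVeq using entry
  have lower : ∀ i x, ¬ IsExtremeBid ξ i (b i) → -1 ≤ x → x < b i →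
      StablePair ξ (Function.update b i x) (Ld i) (Ud i) := by
    intro i x hi hx1 hx
    obtain ⟨S, -, -, -, hS⟩ := exists_eq_xiStar ξ ((hd i hi).1.trans (hUV i hi)) (hiV i hi)
    obtain ⟨L, U, h⟩ := ih i x (bidWeight_lt_of_lt hx hi ⟨S, Or.inr (hS.trans (hVeq i hi))⟩)
    obtain ⟨rfl, rfl⟩ := eq_drop i x L U hi hx1 hx h
    exact h
  have disj : ∀ m j, ¬ IsExtremeBid ξ m (b m) → ¬ IsExtremeBid ξ j (b j) → j ∉ Ld m := by
    intro m j hm hj hjm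
    have hne : j ≠ m := fun e => hdU m hm ((hd m hm).1 (e ▸ hjm))
    have hprice : xiStar ξ (Ld m) (Ud m) j < b j := by
      simpa [hne] using (hd m hm).2.1 j hjm
    obtain ⟨v, hv, hvb⟩ := exists_between hprice
    have h0 : 0 ≤ xiStar ξ (Ld m) (Ud m) j := xiStar_nonneg hξ
    have hM := lower j v hj (by linarith) hvb
    have change : ∀ x, StablePair ξ (Function.update b m x) (Ld m) (Ud m) →
        StablePair ξ (Function.update (Function.update b j v) m x) (Ld m) (Ud m) := by
      intro x hs
      refine hs.congr_bid (fun l hl => ?_) (fun l hl => ?_) (fun l hl => ?_)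
      · by_cases e : l = j
        · subst e
          simpa [hne] using hv
        · simpa [Function.update_apply, e] using hs.2.1 l hl
      · have : l ≠ j := fun e => (mem_sdiff.1 hl).2 (e ▸ hjm)
        simp [Function.update_apply, this]
      · have : l ≠ j := fun e => hl (e ▸ hs.1 hjm)
        simp [Function.update_apply, this]
    by_cases hmM : m ∈ Ld j
    · have hp : xiStar ξ (Ld j) (Ud j) m < b m := by
        simpa [hne.symm] using hM.2.1 m hmM
      obtain ⟨w, hw, hwb⟩ := exists_between hp
      have h0 : 0 ≤ xiStar ξ (Ld j) (Ud j) m := xiStar_nonneg hξ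
      have h1 := change w (lower m w hm (by linarith) hwb)
      have h2 : StablePair ξ (Function.update (Function.update b j v) m w) (Ld j) (Ud j) := by
        refine hM.congr_bid (fun l hl => ?_) (fun l hl => ?_) (fun l hl => ?_)
        · by_cases e : l = m
          · subst e
            simpa using hw
          · simpa [e] using hM.2.1 l hl
        · have : l ≠ m := fun e => (mem_sdiff.1 hl).2 (e ▸ hmM)
          simp [this]
        · have : l ≠ m := fun e => hl (e ▸ hM.1 hmM)
          simp [this]
      have := (h1.unique hξ hFM h2).1
      exact hdU m hm ((hd m hm).1 (this ▸ hmM))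
    · refine hdU j hj ((hM.comparison hξ hFM (change (-1) (hd m hm)) (fun l hl _ => ?_)
        (fun l hl _ => ?_)).1 ((hd m hm).1 hjm))
      · have : l ≠ m := fun e => hmM (e ▸ hl)
        simp [this]
      · have : l ≠ m := fun e => hdU m hm (e ▸ hl)
        simp [this]
  set B : Finset (Fin n) := {i | ∀ S, ξ i S < b i} with hB
  set W : Finset (Fin n) := {i | 0 ≤ b i} with hW
  have hBW : B ⊆ W := fun i hi => by
    rw [hB, mem_filter_univ] at hi
    rw [hW, mem_filter_univ]
    exact (hξ.1 i ∅).trans (hi ∅).le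
  have extreme : ∀ i ∈ W, i ∉ B → ¬ IsExtremeBid ξ i (b i) := fun i hi hiB h => by
    rw [hW, mem_filter_univ] at hi
    rw [hB, mem_filter_univ] at hiB
    exact h.elim hi.not_gt hiB
  have hLB : ∀ i, ¬ IsExtremeBid ξ i (b i) → Ld i = B := by
    intro i hi
    refine Subset.antisymm (fun l hl => ?_) fun l hl => ?_
    · by_contra hlB
      refine disj i l hi (extreme l ?_ hlB) hl
      have : l ≠ i := fun e => hdU i hi ((hd i hi).1 (e ▸ hl))
      have h1 := (hd i hi).2.1 l hl
      rw [Function.update_of_ne this] at h1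
      rw [hW, mem_filter_univ]
      exact (xiStar_nonneg hξ).trans h1.le
    · rw [hB, mem_filter_univ] at hl
      have : l ≠ i := fun e => hi (Or.inr (e ▸ hl))
      exact (hd i hi).mem_of_forall_lt (by simpa [this] using hl)
  have hWle : ∀ i ∈ W, i ∉ B → xiStar ξ B W i ≤ b i := by
    intro i hi hiB
    have he := extreme i hi hiB
    have hVW : V i ⊆ W := fun j hj => by
      rw [hW, mem_filter_univ]
      exact (xiStar_nonneg hξ).trans (hVle i he j hj)
    rw [← hVeq i he, hLB i he]
    exact xiStar_mono hξ Subset.rfl (hLB i he ▸ (hd i he).1.trans (hUV i he)) hVW (hiV i he)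
  refine hfail B W ⟨hBW, fun i hi => ?_, fun i hi => ?_, fun R hR hne => ?_⟩
  · obtain ⟨S, -, -, -, hS⟩ := exists_eq_xiStar ξ hBW (hBW hi)
    rw [hB, mem_filter_univ] at hi
    exact hS ▸ hi S
  · obtain ⟨hi, hiB⟩ := mem_sdiff.1 hi
    have he := extreme i hi hiB
    refine ((hWle i hi hiB).eq_of_not_lt fun hlt => ?_).symm
    have h0 : 0 ≤ xiStar ξ B W i := xiStar_nonneg hξ
    have hs := lower i _ he (by linarith) hlt
    rw [hLB i he] at hs
    obtain ⟨j, hj, hjU, hjlt⟩ := hs.exists_lt fun hsub => hdU i he (hsub hi)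
    have hle : xiStar ξ B (Ud i ∪ W) j ≤ xiStar ξ B W j :=
      xiStar_mono hξ Subset.rfl hBW subset_union_right hj
    by_cases e : j = i
    · subst e
      rw [Function.update_self] at hjlt
      exact hjlt.not_ge hle
    · rw [Function.update_of_ne e] at hjlt
      exact hjlt.not_ge (hle.trans (hWle j hj fun hjB => hjU (hs.1 hjB)))
  · obtain ⟨i, hi⟩ := hne
    have : i ∉ W := by simpa using hR hi
    rw [hW, mem_filter_univ, not_le] at this
    exact ⟨i, hi, this.trans_le (xiStar_nonneg hξ)⟩

theorem exists_stablePair {ξ : Fin n → Finset (Fin n) → ℝ} (hξ : IsCostSharingScheme ξ)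
    (hFM : FenceMonotone ξ) (b : Fin n → ℝ) : ∃ L U, StablePair ξ b L U := by
  induction hk : ∑ j, bidWeight ξ j (b j) using Nat.strong_induction_on generalizing b with
  | _ k ih =>
    exact exists_stablePair_of_update hξ hFM b fun i x hx =>
      ih _ (hk ▸ sum_bidWeight_update_lt hx) _ rfl

/-- Under Fence Monotonicity, every bid vector has a (unique) stable pair. -/
theorem stmt14 (ξ : Fin n → Finset (Fin n) → ℝ) (hξ : IsCostSharingScheme ξ)
    (hFM : FenceMonotone ξ) (b : Fin n → ℝ) :
    ∃! p : Finset (Fin n) × Finset (Fin n), StablePair ξ b p.1 p.2 := by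
  obtain ⟨L, U, h⟩ := exists_stablePair hξ hFM b
  refine ⟨(L, U), h, fun p hp => ?_⟩
  obtain ⟨h1, h2⟩ := StablePair.unique hξ hFM hp h
  exact Prod.ext h1 h2
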